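/- arXiv:2604.03097 — 2 statements merged into one kernel-verified Lean document; each statement's English description precedes it below -/
import Mathlib

section
/- Let α, β, γ, r₁, r₂ be real numbers with γ = −α, α ≠ 0, β ≠ 0 and β ≠ −1. Define F₁(u₁,u₂) = α u₁ (1 − r₁ u₂²) + u₂ (1 − r₂ u₁) and F₂(u₁,u₂) = β u₂ (1 + (α r₁ / β) u₁ u₂) + u₁ (γ + r₂ u₂). Then for real numbers u₁, u₂ one has F₁(u₁,u₂) = 0 and F₂(u₁,u₂) = 0 if and only if (u₁, u₂) = (0, 0); that is, (0,0) is the unique equilibrium point of the reaction kinetics. -/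
/-- For the Turing reaction kinetics
`F₁(u₁,u₂) = α u₁ (1 − r₁ u₂²) + u₂ (1 − r₂ u₁)` and
`F₂(u₁,u₂) = β u₂ (1 + (α r₁ / β) u₁ u₂) + u₁ (γ + r₂ u₂)`,
with `γ = −α`, `α ≠ 0`, `β ≠ 0`, `β ≠ −1`, the point `(0,0)` is the unique
equilibrium: `F₁(u₁,u₂) = 0 ∧ F₂(u₁,u₂) = 0 ↔ (u₁,u₂) = (0,0)`. -/
theorem turing_unique_equilibrium (α β γ r₁ r₂ : ℝ)
    (hγ : γ = -α) (hα : α ≠ 0) (hβ : β ≠ 0) (hβ' : β ≠ -1) (u₁ u₂ : ℝ) :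
    (α * u₁ * (1 - r₁ * u₂ ^ 2) + u₂ * (1 - r₂ * u₁) = 0 ∧
      β * u₂ * (1 + (α * r₁ / β) * u₁ * u₂) + u₁ * (γ + r₂ * u₂) = 0) ↔
    (u₁, u₂) = (0, 0) := by
  constructor
  · rintro ⟨h1, h2⟩
    have e : β * u₂ * (1 + (α * r₁ / β) * u₁ * u₂) = β * u₂ + α * r₁ * u₁ * u₂ ^ 2 := by
      field_simp
    rw [e, hγ] at h2
    have h3 : (β + 1) * u₂ = 0 := by linear_combination h1 + h2
    have hb : β + 1 ≠ 0 := fun h => hβ' (by linarith)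
    have hu2 : u₂ = 0 := (mul_eq_zero.mp h3).resolve_left hb
    subst hu2
    have h4 : α * u₁ = 0 := by linear_combination h1
    have hu1 : u₁ = 0 := (mul_eq_zero.mp h4).resolve_left hα
    rw [hu1]
  · intro h
    obtain ⟨rfl, rfl⟩ := Prod.mk.inj h
    constructor <;> simp
end

section
/- Let s ≥ 1 be a natural number. There do not exist a real number ω and real coefficients a₀, …, a_{s−1} such that ∑_{i=0}^{s−1} a_i = 1 and, for every integer k with 1 ≤ k ≤ s+1, ∑_{i=0}^{s−1} a_i (−i)^k = 1 − k·ω. Equivalently, the implicit (backward-differentiation) part of an s-step IMEX-BDF scheme, which uses the s past solution values u^{n}, …, u^{n−s+1} and a single implicit derivative evaluation at time level n+1 with weight ω, cannot be exact on all polynomials of degree ≤ s+1, and hence cannot achieve order of accuracy higher than s. -/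
/-- Order barrier for the implicit (BDF) part of an `s`-step IMEX-BDF scheme:
there are no weight `ω` and coefficients `a₀, …, a_{s−1}` with `∑ aᵢ = 1` and
`∑ᵢ aᵢ (−i)ᵏ = 1 − k ω` for all `1 ≤ k ≤ s + 1`; i.e. the scheme cannot be exact
on all polynomials of degree ≤ s + 1, hence cannot exceed order `s`. -/
theorem imex_bdf_order_barrier (s : ℕ) (hs : 1 ≤ s) :
    ¬ ∃ (ω : ℝ) (a : Fin s → ℝ),
      (∑ i : Fin s, a i = 1) ∧
      ∀ k : ℕ, 1 ≤ k → k ≤ s + 1 →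
        ∑ i : Fin s, a i * (-(i : ℝ)) ^ k = 1 - (k : ℝ) * ω := by
  rintro ⟨ω, a, h0, h⟩
  have h' : ∀ k : ℕ, k < s + 2 →
      ∑ i : Fin s, a i * (-(i : ℝ)) ^ k = 1 - (k : ℝ) * ω := by
    intro k hk
    rcases Nat.eq_zero_or_pos k with rfl | hp
    · simpa using h0
    · exact h k hp (by omega)
  have key : ∀ p : Polynomial ℝ, p.natDegree < s + 2 →
      ∑ i : Fin s, a i * p.eval (-(i : ℝ)) = p.eval 1 - ω * p.derivative.eval 1 := by
    intro p hp
    rw [Polynomial.derivative_eval, Polynomial.sum_over_range' p (by simp) (s + 2) hp]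
    simp only [Polynomial.eval_eq_sum_range' hp, Finset.mul_sum]
    rw [Finset.sum_comm, ← Finset.sum_sub_distrib]
    refine Finset.sum_congr rfl fun k hk => ?_
    have e := h' k (Finset.mem_range.mp hk)
    calc ∑ i : Fin s, a i * (p.coeff k * (-(i : ℝ)) ^ k)
        = p.coeff k * ∑ i : Fin s, a i * (-(i : ℝ)) ^ k := by
          rw [Finset.mul_sum]
          exact Finset.sum_congr rfl fun i _ => by ring
      _ = _ := by rw [e]; simp only [one_pow]; ring
  set Q : Polynomial ℝ := ∏ i : Fin s, (Polynomial.X - Polynomial.C (-(i : ℝ))) with hQ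
  have hdeg : Q.natDegree = s := by
    rw [hQ, Polynomial.natDegree_finsetProd_X_sub_C_eq_card]; simp
  have hroot : ∀ i : Fin s, Q.eval (-(i : ℝ)) = 0 := by
    intro i
    rw [hQ, Polynomial.eval_prod]
    exact Finset.prod_eq_zero (Finset.mem_univ i) (by simp)
  have hpos : 0 < Q.eval 1 := by
    rw [hQ, Polynomial.eval_prod]
    refine Finset.prod_pos fun i _ => ?_
    simp only [Polynomial.eval_sub, Polynomial.eval_X, Polynomial.eval_C]
    have : (0 : ℝ) ≤ (i : ℝ) := Nat.cast_nonneg _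
    linarith
  have k1 := key Q (by omega)
  have k2 := key ((Polynomial.X - Polynomial.C 1) * Q) (by
    have := Polynomial.natDegree_mul_le (p := Polynomial.X - Polynomial.C (1 : ℝ)) (q := Q)
    rw [Polynomial.natDegree_X_sub_C] at this
    omega)
  simp only [hroot, Polynomial.derivative_mul, Polynomial.eval_mul, Polynomial.eval_add,
    Polynomial.eval_sub, Polynomial.eval_X, Polynomial.eval_C, Polynomial.derivative_X_sub_C,
    Polynomial.eval_one, mul_zero, Finset.sum_const_zero, sub_self, zero_mul, one_mul, add_zero,
    zero_sub] at k1 k2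
  have hω : ω = 0 := by
    rcases mul_eq_zero.mp (neg_eq_zero.mp k2.symm) with h | h
    · exact h
    · exact absurd h hpos.ne'
  rw [hω] at k1
  linarith
end
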